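/- Let α ∈ ℝ and β ≠ 0, and set c_β = 1 + 1/|β| − 1/p_β if β is rational (with |β| = p_β/q_β in lowest terms) and c_β = 1 + 1/|β| if β is irrational. If μ₁ and μ₂ are both CIUPMs for T_{α,β} whose supports have diameter equal to c_β, then there exists γ ∈ ℝ such that μ₂ equals the pushforward of μ₁ under the translation x ↦ x + γ; that is, the CIUPM with support of diameter c_β is unique up to translation. -/

import Mathlib

open MeasureTheory Set
open scoped Classical

/-- The linear transformation `T_{α,β}(x) = βx + α`. -/
def T (α β : ℝ) : ℝ → ℝ := fun x => β * x + α

/-- A probability measure `μ` on `ℝ` is a CIUPM for a map `S : ℝ → ℝ` if the pushforwards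
of `μ` and of `μ ∘ S⁻¹` under the fractional-part map both equal Lebesgue measure
restricted to `[0,1)`. -/
def IsCIUPM (S : ℝ → ℝ) (μ : Measure ℝ) : Prop :=
  μ.map Int.fract = volume.restrict (Ico (0 : ℝ) 1) ∧
    (μ.map S).map Int.fract = volume.restrict (Ico (0 : ℝ) 1)

/-- The topological support of a measure on `ℝ`: the set of points all of whose
neighbourhoods have positive measure (the smallest closed set of full measure). -/
def msupp (μ : Measure ℝ) : Set ℝ := {x : ℝ | ∀ U ∈ nhds x, 0 < μ U}

/-- The threshold constant `c_β`: if `β` is rational with `|β| = p_β/q_β` in lowest terms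
then `c_β = 1 + 1/|β| - 1/p_β`; if `β` is irrational then `c_β = 1 + 1/|β|`.
(For a rational `r` with `(r : ℝ) = β`, the numerator of `|r|` is `r.num.natAbs`,
since rationals in Lean are stored in lowest terms.) -/
noncomputable def cbeta (β : ℝ) : ℝ :=
  if h : ∃ r : ℚ, (r : ℝ) = β then 1 + 1 / |β| - 1 / (h.choose.num.natAbs : ℝ)
  else 1 + 1 / |β|

/-- The sum over the translates of `f` by integer multiples of `b`, regularized by subtracting
the comparison function `P` on the translates with nonnegative index. -/
noncomputable def regSum (f P : ℝ → ℝ) (b x : ℝ) : ℝ :=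
  ∑' n : ℤ, (f (x + n * b) - if 0 ≤ n then P (x + n * b) else 0)

lemma summable_of_eventually_zero {g : ℤ → ℝ} {A B : ℝ} (h0 : ∀ n : ℤ, (n : ℝ) ≤ A → g n = 0)
    (h1 : ∀ n : ℤ, B ≤ (n : ℝ) → g n = 0) : Summable g := by
  apply summable_of_hasFiniteSupport
  refine (Set.finite_Icc ⌊A⌋ ⌈B⌉).subset fun n hn => ?_
  rw [Function.mem_support] at hn
  constructor
  · by_contra! h
    exact hn (h0 n (Int.le_floor.1 h.le))
  · by_contra! h
    exact hn (h1 n (Int.ceil_le.1 h.le))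

lemma summable_regSum {f P : ℝ → ℝ} {b A B : ℝ} (hb : 0 < b) (h0 : ∀ x ≤ A, f x = 0)
    (h1 : ∀ x, B ≤ x → f x = P x) (x : ℝ) :
    Summable fun n : ℤ => f (x + n * b) - if 0 ≤ n then P (x + n * b) else 0 := by
  apply summable_of_eventually_zero (A := min (-1) ((A - x) / b)) (B := max 0 ((B - x) / b))
  · intro n hn
    rw [le_min_iff, le_div_iff₀ hb] at hn
    have : n < 0 := by
      have : (n : ℝ) < 0 := by linarith
      exact_mod_cast this
    rw [if_neg (not_le.2 this), h0 _ (by linarith), sub_zero]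
  · intro n hn
    rw [max_le_iff, div_le_iff₀ hb] at hn
    have : 0 ≤ n := by exact_mod_cast hn.1
    rw [if_pos this, h1 _ (by linarith), sub_self]

lemma regSum_add_period {f P : ℝ → ℝ} {b A B : ℝ} (hb : 0 < b) (h0 : ∀ x ≤ A, f x = 0)
    (h1 : ∀ x, B ≤ x → f x = P x) (x : ℝ) :
    regSum f P b (x + b) = regSum f P b x + P x := by
  have hs := (summable_regSum hb h0 h1 x).hasSum
  have hs' := (Equiv.addRight (1 : ℤ)).hasSum_iff.2 hs
  have h2 : HasSum (fun n : ℤ => if n = -1 then P x else 0) (P x) := hasSum_ite_eq (-1) (P x)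
  refine ((hs'.add h2).congr_fun ?_).tsum_eq
  intro n
  change _ = (f (x + ((n + 1 : ℤ) : ℝ) * b) - if 0 ≤ n + 1 then P (x + ((n + 1 : ℤ) : ℝ) * b) else 0)
    + if n = -1 then P x else 0
  have e : x + b + (n : ℝ) * b = x + ((n + 1 : ℤ) : ℝ) * b := by push_cast; ring
  rw [e]
  rcases lt_trichotomy n (-1) with h | h | h
  · rw [if_neg (by omega), if_neg (by omega), if_neg (by omega)]; ring
  · subst h; norm_num
  · rw [if_pos (by omega), if_pos (by omega), if_neg (by omega)]; ring

/-- The primitive `H` of a function `F` that is the distribution function of a measure with uniform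
reduction modulo `1`. -/
lemma exists_primitive {F : ℝ → ℝ} {c K : ℝ} (hF : Monotone F) (h0 : ∀ x ≤ 0, F x = 0)
    (h1 : ∀ x, c ≤ x → F x = 1) (hK : ∀ x, regSum F (fun _ => 1) 1 x = x + K) :
    ∃ (H : ℝ → ℝ) (K₁ : ℝ), (∀ x, F x = H x - H (x - 1)) ∧ (∀ x ≤ 0, H x = 0) ∧
      (∀ x, c - 1 ≤ x → H x = x + K₁) ∧ Monotone H ∧ Monotone fun x => x - H x := by
  set h : ℝ → ℤ → ℝ := fun x n => if n ≤ 0 then F (x + n) else 0 with hh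
  set j : ℝ → ℤ → ℝ := fun x n => if n ≤ 0 then 0 else F (x + n) - 1 with hj
  have hsh : ∀ x, Summable (h x) := fun x =>
    summable_of_eventually_zero (A := -x) (B := 1) (fun n hn => by
      simp only [hh]; split_ifs
      · exact h0 _ (by linarith)
      · rfl) (fun n hn => by
      have : 1 ≤ n := by exact_mod_cast hn
      simp only [hh]; rw [if_neg (by omega)])
  have hsj : ∀ x, Summable (j x) := fun x =>
    summable_of_eventually_zero (A := 0) (B := c - x) (fun n hn => by
      have : n ≤ 0 := by exact_mod_cast hn
      simp only [hj]; rw [if_pos (by omega)]) (fun n hn => by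
      simp only [hj]; split_ifs
      · rfl
      · rw [h1 _ (by linarith), sub_self])
  have hsum : ∀ x, (∑' n, h x n) + (∑' n, j x n) = x + (K + 1) := by
    intro x
    have h2 : HasSum (fun n : ℤ => if n = 0 then (-1 : ℝ) else 0) (-1) := hasSum_ite_eq 0 (-1)
    have := (((hsh x).hasSum.add (hsj x).hasSum).add h2).congr_fun
      (g := fun n : ℤ => F (x + n * 1) - if 0 ≤ n then 1 else 0) ?_
    · have e := this.tsum_eq
      have e' := hK x
      unfold regSum at e'
      rw [e'] at e
      linarith
    · intro n
      simp only [hh, hj, mul_one]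
      rcases lt_trichotomy n 0 with h | h | h
      · rw [if_neg (by omega), if_pos (by omega), if_pos (by omega), if_neg (by omega)]; ring
      · subst h; norm_num; ring
      · rw [if_pos (by omega), if_neg (by omega), if_neg (by omega), if_neg (by omega)]; ring
  have hHm : Monotone fun x => ∑' n, h x n := by
    intro x y hxy
    refine (hsh x).tsum_le_tsum (fun n => ?_) (hsh y)
    simp only [hh]; split_ifs
    · exact hF (by linarith)
    · exact le_rfl
  have hJm : Monotone fun x => ∑' n, j x n := by
    intro x y hxy
    refine (hsj x).tsum_le_tsum (fun n => ?_) (hsj y)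
    simp only [hj]; split_ifs
    · exact le_rfl
    · linarith [hF (show x + (n : ℝ) ≤ y + n by linarith)]
  refine ⟨fun x => ∑' n, h x n, K + 1, ?_, ?_, ?_, hHm, ?_⟩
  · intro x
    have hs := (Equiv.addRight (1 : ℤ)).hasSum_iff.2 (hsh (x - 1)).hasSum
    have h2 : HasSum (fun n : ℤ => if n = 0 then F x else 0) (F x) := hasSum_ite_eq 0 (F x)
    have := ((hs.add h2).congr_fun (g := h x) ?_).tsum_eq
    · simp only [this]; ring
    · intro n
      have e : x - 1 + ((n + 1 : ℤ) : ℝ) = x + n := by push_cast; ring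
      simp only [hh, Function.comp, Equiv.coe_addRight, e]
      rcases lt_trichotomy n 0 with h | h | h
      · rw [if_pos (by omega), if_pos (by omega), if_neg (by omega)]; ring
      · subst h; norm_num
      · rw [if_neg (by omega), if_neg (by omega), if_neg (by omega)]; ring
  · intro x hx
    have : h x = fun _ => 0 := by
      funext n
      simp only [hh]; split_ifs with hn
      · have : (n : ℝ) ≤ 0 := by exact_mod_cast hn
        exact h0 _ (by linarith)
      · rfl
    simp [this]
  · intro x hx
    have : j x = fun _ => 0 := by
      funext n
      simp only [hj]; split_ifs with hn
      · rfl
      · have : (1 : ℝ) ≤ n := by exact_mod_cast (not_le.1 hn)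
        rw [h1 _ (by linarith), sub_self]
    have := hsum x
    simp_all
  · intro x y hxy
    have := hJm hxy
    have a := hsum x
    have b := hsum y
    simp only at this ⊢
    linarith

lemma continuous_of_periodic_of_continuousOn {D : ℝ → ℝ} {b : ℝ} (hb : 0 < b)
    (hD : Function.Periodic D b) (hc : ContinuousOn D (Icc 0 b)) : Continuous D := by
  have h1 : ContinuousOn (fun y => D (b * y)) (Icc 0 1) := by
    refine hc.comp (by fun_prop) fun y hy => ⟨mul_nonneg hb.le hy.1, ?_⟩
    nlinarith [hy.2]
  have h2 : Continuous ((fun y => D (b * y)) ∘ Int.fract) :=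
    h1.comp_fract'' (by simpa using (hD 0).symm)
  have h3 : D = ((fun y => D (b * y)) ∘ Int.fract) ∘ fun x => x / b := by
    funext x
    have : b * Int.fract (x / b) = x - ⌊x / b⌋ * b := by
      rw [Int.fract]; field_simp
    simp only [Function.comp, this]
    exact (hD.sub_int_mul_eq _).symm
  rw [h3]
  exact h2.comp (by fun_prop)

lemma periodic_of_bounded_of_add_const {D : ℝ → ℝ} {κ M : ℝ} (hM : ∀ x, |D x| ≤ M)
    (hκ : ∀ x, D (x + 1) = D x + κ) : Function.Periodic D 1 := by
  have h1 : ∀ n : ℕ, D n = D 0 + n * κ := by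
    intro n
    induction n with
    | zero => simp
    | succ n ih => push_cast; rw [hκ, ih]; ring
  have h2 : κ = 0 := by
    by_contra h
    obtain ⟨n, hn⟩ := exists_nat_gt (2 * M / |κ|)
    rw [div_lt_iff₀ (abs_pos.2 h)] at hn
    have h3 : |(n : ℝ) * κ| ≤ 2 * M := by
      have : (n : ℝ) * κ = D n - D 0 := by rw [h1]; ring
      rw [this]
      linarith [abs_sub (D n) (D 0), hM n, hM 0]
    rw [abs_mul, Nat.abs_cast] at h3
    linarith
  intro x
  rw [hκ, h2, add_zero]

lemma continuous_of_monotone_of_monotone_sub {H : ℝ → ℝ} (hH : Monotone H)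
    (hH' : Monotone fun x => x - H x) : Continuous H := by
  refine (LipschitzWith.of_le_add fun x y => ?_).continuous
  rw [Real.dist_eq]
  rcases le_total x y with h | h
  · linarith [hH h, abs_nonneg (x - y)]
  · have := hH' h
    simp only at this
    linarith [le_abs_self (x - y)]

/-- If `F` is the distribution function of a measure with uniform reductions modulo `1` and modulo
`b`, its primitive `H` is, on `[0, b]`, a quadratic polynomial plus a function with periods
`1` and `b`. -/
lemma exists_primitive_eq_periodic_add {F : ℝ → ℝ} {b c K K' : ℝ} (hb : 0 < b) (hcb : c ≤ 1 + b)
    (hF : Monotone F) (h0 : ∀ x ≤ 0, F x = 0) (h1 : ∀ x, c ≤ x → F x = 1)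
    (hK : ∀ x, regSum F (fun _ => 1) 1 x = x + K)
    (hK' : ∀ x, regSum F (fun _ => 1) b x = x / b + K') :
    ∃ (H D : ℝ → ℝ) (K₁ : ℝ), (∀ x, F x = H x - H (x - 1)) ∧ (∀ x ≤ 0, H x = 0) ∧
      (∀ x, c - 1 ≤ x → H x = x + K₁) ∧ Monotone H ∧ (Monotone fun x => x - H x) ∧
      Continuous D ∧ Function.Periodic D 1 ∧ Function.Periodic D b ∧
      ∀ x ∈ Icc 0 b, H x = D x + x ^ 2 / (2 * b) + (K₁ / b + 1 / 2) * x + K₁ := by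
  obtain ⟨H, K₁, hFH, hH0, hH1, hHm, hHm'⟩ := exists_primitive hF h0 h1 hK
  have hH1' : ∀ x, b ≤ x → H x = (fun y => y + K₁) x := fun x hx => hH1 x (by linarith)
  set E := regSum H (fun y => y + K₁) b with hE
  set D : ℝ → ℝ := fun x => E x - (x ^ 2 / (2 * b) + (K₁ / b - 1 / 2) * x) with hD
  have hDb : Function.Periodic D b := by
    intro x
    simp only [hD]
    rw [hE, regSum_add_period hb hH0 hH1' x]
    field_simp
    ring
  have hE1 : ∀ x, E (x + 1) = E x + ((x + 1) / b + K') := by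
    intro x
    have s1 := (summable_regSum hb hH0 hH1' (x + 1))
    have s2 := (summable_regSum hb hH0 hH1' x)
    have := s1.tsum_sub s2
    have e : E (x + 1) - E x = regSum F (fun _ => 1) b (x + 1) := by
      rw [hE, regSum, regSum, ← this, regSum]
      congr 1
      funext n
      have e : x + 1 + (n : ℝ) * b - 1 = x + n * b := by ring
      rw [hFH, e]
      split_ifs <;> ring
    rw [hK'] at e
    linarith
  have hDH : ∀ x ∈ Icc 0 b, H x = D x + x ^ 2 / (2 * b) + (K₁ / b + 1 / 2) * x + K₁ := by
    intro x hx
    have e : E x = H x - (x + K₁) := by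
      rw [hE, regSum, tsum_eq_single 0]
      · simp
      · intro n hn
        rcases lt_or_gt_of_ne hn with h | h
        · have : (n : ℝ) ≤ -1 := by exact_mod_cast (by omega : n ≤ -1)
          rw [if_neg (by omega), hH0 _ (by nlinarith [hx.2]), sub_zero]
        · have : (1 : ℝ) ≤ n := by exact_mod_cast (by omega : 1 ≤ n)
          rw [if_pos (by omega), hH1' _ (by nlinarith [hx.1]), sub_self]
    simp only [hD, e]
    ring
  have hHc := continuous_of_monotone_of_monotone_sub hHm hHm'
  have hDc : Continuous D := by
    refine continuous_of_periodic_of_continuousOn hb hDb ?_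
    have : Continuous fun x => H x - (x ^ 2 / (2 * b) + (K₁ / b + 1 / 2) * x + K₁) := by fun_prop
    refine this.continuousOn.congr fun x hx => ?_
    simp only [hDH x hx]
    ring
  have hD1 : Function.Periodic D 1 := by
    obtain ⟨M, hM⟩ := (hDb.compact_of_continuous hb.ne' hDc).isBounded.exists_norm_le
    refine periodic_of_bounded_of_add_const (M := M)
      (κ := 1 / (2 * b) + K' - K₁ / b + 1 / 2) (fun x => hM _ ⟨x, rfl⟩) fun x => ?_
    simp only [hD, hE1]
    field_simp
    ring
  exact ⟨H, D, K₁, hFH, hH0, hH1, hHm, hHm', hDc, hD1, hDb, hDH⟩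

lemma const_of_dense_periods {D : ℝ → ℝ} {b : ℝ} (hb : Irrational b) (hc : Continuous D)
    (h1 : Function.Periodic D 1) (h2 : Function.Periodic D b) (x : ℝ) : D x = D 0 := by
  have hd : Dense (AddSubgroup.closure {b, 1} : Set ℝ) := by
    rw [dense_addSubgroupClosure_pair_iff]
    simpa using hb
  have heq : D = fun _ => D 0 := by
    refine hc.ext_on hd continuous_const fun y hy => ?_
    obtain ⟨m, n, rfl⟩ := AddSubgroup.mem_closure_pair.1 hy
    exact ((h2.zsmul m).add_period (h1.zsmul n)).eq
  exact congrFun heq x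

lemma eq_of_irrational {F : ℝ → ℝ} {b K K' : ℝ} (hb : 0 < b) (hbi : Irrational b)
    (hF : Monotone F) (h0 : ∀ x ≤ 0, F x = 0) (h1 : ∀ x, 1 + b ≤ x → F x = 1)
    (hK : ∀ x, regSum F (fun _ => 1) 1 x = x + K)
    (hK' : ∀ x, regSum F (fun _ => 1) b x = x / b + K') :
    let H : ℝ → ℝ := fun x => if x ≤ 0 then 0 else if x ≤ b then x ^ 2 / (2 * b) else x - b / 2
    ∀ x, F x = H x - H (x - 1) := by
  obtain ⟨H, D, K₁, hFH, hH0, hH1, hHm, hHm', hDc, hD1, hDb, hDH⟩ :=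
    exists_primitive_eq_periodic_add hb le_rfl hF h0 h1 hK hK'
  have hDconst := const_of_dense_periods hbi hDc hD1 hDb
  have hD0 : D 0 = -K₁ := by
    have := hDH 0 ⟨le_rfl, hb.le⟩
    rw [hH0 0 le_rfl] at this
    simp at this
    linarith
  set l := K₁ / b + 1 / 2 with hl
  have hHq : ∀ x ∈ Icc 0 b, H x = x ^ 2 / (2 * b) + l * x := by
    intro x hx
    rw [hDH x hx, hDconst, hD0]
    ring
  have l1 : 0 ≤ l := by
    by_contra! h
    set x := min b (-l * b) with hx
    have hx0 : 0 < x := lt_min hb (by nlinarith)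
    have := hHq x ⟨hx0.le, min_le_left _ _⟩
    have h2 := hHm hx0.le
    rw [hH0 0 le_rfl, this] at h2
    have h3 : x ^ 2 / (2 * b) ≤ -l * x / 2 := by
      rw [div_le_div_iff₀ (by positivity) (by norm_num)]
      nlinarith [min_le_right b (-l * b)]
    nlinarith
  have l2 : l ≤ 0 := by
    by_contra! h
    set y := min b (l * b) with hy
    have hy0 : 0 < y := lt_min hb (by nlinarith)
    have hyb : y ≤ b := min_le_left _ _
    have e1 := hHq (b - y) ⟨by linarith, by linarith⟩
    have e2 := hHq b ⟨hb.le, le_rfl⟩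
    have h2 := hHm' (show b - y ≤ b by linarith)
    simp only [e1, e2] at h2
    have h3 : y ^ 2 / (2 * b) ≤ l * y / 2 := by
      rw [div_le_div_iff₀ (by positivity) (by norm_num)]
      nlinarith [min_le_right b (l * b)]
    have h4 : b ^ 2 / (2 * b) - (b - y) ^ 2 / (2 * b) = y - y ^ 2 / (2 * b) := by
      field_simp; ring
    nlinarith
  have l0 : l = 0 := le_antisymm l2 l1
  have hK1 : K₁ = -(b / 2) := by
    rw [l0] at hl
    field_simp at hl
    linarith
  intro H'
  have : H = H' := by
    funext x
    simp only [H']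
    split_ifs with hx hx'
    · exact hH0 x hx
    · rw [hHq x ⟨(not_le.1 hx).le, hx'⟩, l0]; ring
    · rw [hH1 x (by linarith), hK1]; ring
  rw [← this]
  exact hFH

lemma eq_of_rational {F₁ F₂ : ℝ → ℝ} {p q : ℕ} {b K₁ K₁' K₂ K₂' : ℝ} (hp : 0 < p) (hq : 0 < q)
    (hpq : p.Coprime q) (hbpq : b = q / p)
    (hF₁ : Monotone F₁) (h₁0 : ∀ x ≤ 0, F₁ x = 0) (h₁1 : ∀ x, 1 + b - 1 / p ≤ x → F₁ x = 1)
    (hK₁ : ∀ x, regSum F₁ (fun _ => 1) 1 x = x + K₁)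
    (hK₁' : ∀ x, regSum F₁ (fun _ => 1) b x = x / b + K₁')
    (hF₂ : Monotone F₂) (h₂0 : ∀ x ≤ 0, F₂ x = 0) (h₂1 : ∀ x, 1 + b - 1 / p ≤ x → F₂ x = 1)
    (hK₂ : ∀ x, regSum F₂ (fun _ => 1) 1 x = x + K₂)
    (hK₂' : ∀ x, regSum F₂ (fun _ => 1) b x = x / b + K₂') : F₁ = F₂ := by
  have hp' : (0 : ℝ) < p := by exact_mod_cast hp
  have hq' : (1 : ℝ) ≤ q := by exact_mod_cast hq
  set u : ℝ := 1 / p with hu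
  have hu0 : 0 < u := by positivity
  have hub : u ≤ b := by rw [hbpq, hu]; gcongr
  have hb : 0 < b := hu0.trans_le hub
  obtain ⟨H₁, D₁, k₁, hFH₁, hH0₁, hH1₁, -, -, -, hD1₁, hDb₁, hDH₁⟩ :=
    exists_primitive_eq_periodic_add hb (by linarith) hF₁ h₁0 h₁1 hK₁ hK₁'
  obtain ⟨H₂, D₂, k₂, hFH₂, hH0₂, hH1₂, -, -, -, hD1₂, hDb₂, hDH₂⟩ :=
    exists_primitive_eq_periodic_add hb (by linarith) hF₂ h₂0 h₂1 hK₂ hK₂'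
  have hper : ∀ D : ℝ → ℝ, Function.Periodic D 1 → Function.Periodic D b →
      Function.Periodic D u := by
    intro D h1 h2
    have e : u = ((p.gcdB q : ℤ) : ℝ) * b + ((p.gcdA q : ℤ) : ℝ) * 1 := by
      have := Nat.gcd_eq_gcd_ab p q
      rw [hpq] at this
      have : (1 : ℝ) = p * (p.gcdA q : ℤ) + q * (p.gcdB q : ℤ) := by exact_mod_cast this
      rw [hu, hbpq]
      field_simp
      linarith
    rw [e]
    exact (h2.int_mul _).add_period (h1.int_mul _)
  have hval : ∀ (H D : ℝ → ℝ) (k : ℝ), (∀ x, 1 + b - u - 1 ≤ x → H x = x + k) →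
      (∀ x ∈ Icc 0 b, H x = D x + x ^ 2 / (2 * b) + (k / b + 1 / 2) * x + k) →
      ∀ x ∈ Icc (b - u) b, D x = x - x ^ 2 / (2 * b) - (k / b + 1 / 2) * x := by
    intro H D k hH1 hDH x hx
    have e1 := hH1 x (by linarith [hx.1])
    have e2 := hDH x ⟨by linarith [hx.1], hx.2⟩
    linarith
  have hv₁ := hval H₁ D₁ k₁ hH1₁ hDH₁
  have hv₂ := hval H₂ D₂ k₂ hH1₂ hDH₂
  have hk : k₁ = k₂ := by
    have key : ∀ (D : ℝ → ℝ) (k : ℝ), Function.Periodic D u →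
        (∀ x ∈ Icc (b - u) b, D x = x - x ^ 2 / (2 * b) - (k / b + 1 / 2) * x) →
        k = -(b - u) / 2 := by
      intro D k hD hv
      have e := hD (b - u)
      rw [sub_add_cancel, hv b ⟨by linarith, le_rfl⟩, hv (b - u) ⟨le_rfl, by linarith⟩] at e
      field_simp at e
      have : u * (2 * k - (u - b)) = 0 := by linarith
      rcases mul_eq_zero.1 this with h | h <;> linarith
    rw [key D₁ k₁ (hper _ hD1₁ hDb₁) hv₁, key D₂ k₂ (hper _ hD1₂ hDb₂) hv₂]
  subst hk
  have hD : D₁ = D₂ := by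
    funext x
    set y := toIcoMod hu0 (b - u) x with hy
    have hyx : y = x - toIcoDiv hu0 (b - u) x • u := rfl
    have hy' : y ∈ Icc (b - u) b := by
      have := toIcoMod_mem_Ico hu0 (b - u) x
      rw [sub_add_cancel] at this
      exact Ico_subset_Icc_self this
    rw [← (hper _ hD1₁ hDb₁).sub_zsmul_eq (toIcoDiv hu0 (b - u) x),
      ← (hper _ hD1₂ hDb₂).sub_zsmul_eq (toIcoDiv hu0 (b - u) x), ← hyx, hv₁ y hy', hv₂ y hy']
  have hH : H₁ = H₂ := by
    funext x
    rcases le_or_gt x 0 with h | h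
    · rw [hH0₁ x h, hH0₂ x h]
    rcases le_or_gt x b with h' | h'
    · rw [hDH₁ x ⟨h.le, h'⟩, hDH₂ x ⟨h.le, h'⟩, hD]
    · rw [hH1₁ x (by linarith), hH1₂ x (by linarith)]
  funext x
  rw [hFH₁, hFH₂, hH]

lemma regSum_cdf_eq {ν : Measure ℝ} [IsProbabilityMeasure ν] {A B : ℝ}
    (hν : ν.map Int.fract = volume.restrict (Ico (0 : ℝ) 1))
    (h0 : ∀ x ≤ A, ProbabilityTheory.cdf ν x = 0) (h1 : ∀ x, B ≤ x → ProbabilityTheory.cdf ν x = 1) :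
    ∃ K, ∀ x, regSum (ProbabilityTheory.cdf ν) (fun _ => 1) 1 x = x + K := by
  set F := ProbabilityTheory.cdf ν with hF
  set R := regSum F (fun _ => 1) 1 with hR
  have hper : Function.Periodic (fun x => R x - x) 1 := by
    intro x
    simp only [hR]
    rw [regSum_add_period one_pos h0 h1]
    ring
  have hdiff : ∀ t ∈ Ico (0 : ℝ) 1, R t = t + R 0 := by
    intro t ht
    have hpre : Int.fract ⁻¹' (Ioc 0 t) = ⋃ n : ℤ, Ioc (n : ℝ) (n + t) := by
      ext x
      simp only [mem_preimage, mem_iUnion, mem_Ioc]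
      constructor
      · rintro ⟨hx, hx'⟩
        exact ⟨⌊x⌋, by linarith [Int.self_sub_floor x], by linarith [Int.self_sub_floor x]⟩
      · rintro ⟨n, hn, hn'⟩
        have : Int.fract x = x - n := by
          rw [Int.fract_eq_iff]
          exact ⟨by linarith, by linarith [ht.2], n, by ring⟩
        rw [this]
        exact ⟨by linarith, by linarith⟩
    have hdisj : Pairwise (Function.onFun Disjoint fun n : ℤ => Ioc (n : ℝ) (n + t)) := by
      intro m n hmn
      refine Set.disjoint_left.2 fun x hx hx' => hmn ?_
      have e1 : (m : ℝ) < n + 1 := by linarith [hx.1, hx'.2, ht.2]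
      have e2 : (n : ℝ) < m + 1 := by linarith [hx'.1, hx.2, ht.2]
      have e1' : m < n + 1 := by exact_mod_cast e1
      have e2' : n < m + 1 := by exact_mod_cast e2
      omega
    have hmeas : ν (⋃ n : ℤ, Ioc (n : ℝ) (n + t)) = ENNReal.ofReal t := by
      rw [← hpre, ← Measure.map_apply measurable_fract measurableSet_Ioc, hν,
        Measure.restrict_apply measurableSet_Ioc, inter_eq_left.2, Real.volume_Ioc, sub_zero]
      exact fun x hx => ⟨hx.1.le, hx.2.trans_lt ht.2⟩
    rw [measure_iUnion hdisj fun _ => measurableSet_Ioc] at hmeas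
    have hIoc : ∀ n : ℤ, (ν (Ioc (n : ℝ) (n + t))).toReal = F (t + n) - F n := by
      intro n
      have : ν (Ioc (n : ℝ) (n + t)) = ENNReal.ofReal (F (n + t) - F n) := by
        conv_lhs => rw [← ProbabilityTheory.measure_cdf ν]
        rw [StieltjesFunction.measure_Ioc]
      rw [this, ENNReal.toReal_ofReal, add_comm]
      exact sub_nonneg.2 (ProbabilityTheory.monotone_cdf ν (by linarith [ht.1]))
    have hsum : ∑' n : ℤ, (F (t + n) - F n) = t := by
      have := congrArg ENNReal.toReal hmeas
      rw [ENNReal.tsum_toReal_eq fun _ => measure_ne_top _ _, ENNReal.toReal_ofReal ht.1] at this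
      exact (tsum_congr fun n => (hIoc n).symm).trans this
    have hsub := (summable_regSum one_pos h0 h1 t).tsum_sub (summable_regSum one_pos h0 h1 0)
    have : R t - R 0 = t := by
      refine hsub.symm.trans (Eq.trans (tsum_congr fun n => ?_) hsum)
      simp only [mul_one, zero_add]
      ring
    linarith
  refine ⟨R 0, fun x => ?_⟩
  have e1 := hper.sub_int_mul_eq (x := x) ⌊x⌋
  have e2 : x - (⌊x⌋ : ℝ) * 1 = Int.fract x := by rw [mul_one]; exact Int.self_sub_floor x
  rw [e2] at e1
  have e3 := hdiff _ ⟨Int.fract_nonneg x, Int.fract_lt_one x⟩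
  linarith

lemma map_fract_neg_volume :
    (volume.restrict (Ico (0 : ℝ) 1)).map (fun x => Int.fract (-x))
      = volume.restrict (Ico (0 : ℝ) 1) := by
  have h1 : (fun x : ℝ => Int.fract (-x)) =ᵐ[volume.restrict (Ico (0 : ℝ) 1)] fun x => 1 - x := by
    rw [Filter.EventuallyEq, ae_restrict_iff' measurableSet_Ico]
    have : ∀ᵐ x : ℝ, x ≠ 0 := by simp [ae_iff]
    filter_upwards [this] with x hx0 hx
    rw [Int.fract_eq_iff]
    have : 0 < x := lt_of_le_of_ne hx.1 hx0.symm
    exact ⟨by linarith [hx.2], by linarith, -1, by push_cast; ring⟩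
  rw [Measure.map_congr h1]
  have h2 : MeasurePreserving (fun x : ℝ => 1 - x) volume volume :=
    Measure.measurePreserving_sub_left volume 1
  have h3 := (h2.restrict_preimage (measurableSet_Ioc (a := (0 : ℝ)) (b := 1))).map_eq
  have h4 : (fun x : ℝ => 1 - x) ⁻¹' Ioc 0 1 = Ico 0 1 := by
    ext x
    simp only [mem_preimage, mem_Ioc, mem_Ico]
    constructor <;> rintro ⟨h, h'⟩ <;> constructor <;> linarith
  rw [h4] at h3
  rw [h3]
  exact Measure.restrict_congr_set Ico_ae_eq_Ioc.symm

lemma measurable_T (α β : ℝ) : Measurable (T α β) := by unfold T; fun_prop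

lemma IsCIUPM.neg {α β : ℝ} {μ : Measure ℝ} (h : IsCIUPM (T α β) μ) :
    IsCIUPM (T (-α) (-β)) μ := by
  refine ⟨h.1, ?_⟩
  have hm : Measurable fun x : ℝ => Int.fract (-x) := by fun_prop
  rw [Measure.map_map measurable_fract (measurable_T _ _)]
  have e : Int.fract ∘ T (-α) (-β) = (fun x : ℝ => Int.fract (-x)) ∘ Int.fract ∘ T α β := by
    funext x
    simp only [Function.comp, T]
    rw [Int.fract_eq_fract]
    refine ⟨-⌊β * x + α⌋, ?_⟩
    rw [Int.fract]
    push_cast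
    ring
  rw [e, ← Measure.map_map hm (measurable_fract.comp (measurable_T _ _)),
    ← Measure.map_map measurable_fract (measurable_T _ _), h.2, map_fract_neg_volume]

lemma measure_singleton_eq_zero_of_map_fract {μ : Measure ℝ}
    (h : μ.map Int.fract = volume.restrict (Ico (0 : ℝ) 1)) (x : ℝ) : μ {x} = 0 := by
  refine measure_mono_null (t := Int.fract ⁻¹' {Int.fract x}) (by simp) ?_
  rw [← Measure.map_apply measurable_fract (measurableSet_singleton _), h]
  exact Measure.absolutelyContinuous_of_le Measure.restrict_le_self Real.volume_singleton

lemma exists_measure_compl_Icc_eq_zero {μ : Measure ℝ} [IsProbabilityMeasure μ] {c : ℝ}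
    (hc : 0 ≤ c) (hd : EMetric.diam (msupp μ) = ENNReal.ofReal c) : ∃ m, μ (Icc m (m + c))ᶜ = 0 := by
  have hs : msupp μ = μ.support := by
    ext x
    exact (Measure.mem_support_iff_forall x).symm
  rw [hs] at hd
  have hne : μ.support.Nonempty := Measure.nonempty_support (IsProbabilityMeasure.ne_zero μ)
  have hdist : ∀ x ∈ μ.support, ∀ y ∈ μ.support, y - x ≤ c := by
    intro x hx y hy
    have := Metric.edist_le_ediam_of_mem hy hx
    rw [show Metric.ediam μ.support = ENNReal.ofReal c from hd, edist_dist,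
      ENNReal.ofReal_le_ofReal_iff hc, Real.dist_eq] at this
    exact (le_abs_self _).trans this
  have hbdd : BddBelow μ.support := by
    obtain ⟨y, hy⟩ := hne
    exact ⟨y - c, fun x hx => by linarith [hdist x hx y hy]⟩
  refine ⟨sInf μ.support, measure_mono_null (compl_subset_compl.2 fun x hx => ?_)
    Measure.measure_compl_support⟩
  refine ⟨csInf_le hbdd hx, ?_⟩
  have : x - c ≤ sInf μ.support := le_csInf hne fun y hy => by linarith [hdist y hy x hx]
  linarith

lemma regSum_comp_add (f P : ℝ → ℝ) (b m x : ℝ) :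
    regSum (fun y => f (y + m)) (fun y => P (y + m)) b x = regSum f P b (x + m) := by
  unfold regSum
  refine tsum_congr fun n => ?_
  simp only [add_right_comm]

lemma cdf_map_T {α β : ℝ} (hβ : 0 < β) (μ : Measure ℝ) [IsProbabilityMeasure μ] (x : ℝ) :
    ProbabilityTheory.cdf (μ.map (T α β)) x = ProbabilityTheory.cdf μ ((x - α) / β) := by
  have := Measure.isProbabilityMeasure_map (μ := μ) (measurable_T α β).aemeasurable
  rw [ProbabilityTheory.cdf_eq_real, ProbabilityTheory.cdf_eq_real,
    map_measureReal_apply (measurable_T α β) measurableSet_Iic]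
  congr 1
  ext y
  simp only [mem_preimage, mem_Iic, T, le_div_iff₀ hβ]
  constructor <;> intro h <;> linarith

/-- The distribution function of a CIUPM, normalized so that its support starts at `0`. -/
lemma IsCIUPM.exists_normalized_cdf {α β c : ℝ} (hβ : β ≠ 0) {μ : Measure ℝ}
    [IsProbabilityMeasure μ] (h : IsCIUPM (T α β) μ) (hc : 0 ≤ c)
    (hd : EMetric.diam (msupp μ) = ENNReal.ofReal c) :
    ∃ (F : ℝ → ℝ) (m K K' : ℝ), (∀ x, F x = ProbabilityTheory.cdf μ (x + m)) ∧ Monotone F ∧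
      (∀ x ≤ 0, F x = 0) ∧ (∀ x, c ≤ x → F x = 1) ∧
      (∀ x, regSum F (fun _ => 1) 1 x = x + K) ∧
      ∀ x, regSum F (fun _ => 1) (1 / |β|) x = x / (1 / |β|) + K' := by
  wlog hpos : 0 < β generalizing α β
  · have := this (neg_ne_zero.2 hβ) h.neg (by
      rcases lt_or_gt_of_ne hβ with h | h
      · linarith
      · exact absurd h hpos)
    rwa [abs_neg] at this
  obtain ⟨m, hm⟩ := exists_measure_compl_Icc_eq_zero hc hd
  have h0 : ∀ x ≤ m, ProbabilityTheory.cdf μ x = 0 := by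
    intro x hx
    rw [ProbabilityTheory.cdf_eq_real, Measure.real,
      measure_mono_null (t := (Icc m (m + c))ᶜ ∪ {m}) _ (measure_union_null hm
        (measure_singleton_eq_zero_of_map_fract h.1 m)), ENNReal.toReal_zero]
    intro y hy
    rcases eq_or_lt_of_le ((mem_Iic.1 hy).trans hx) with h | h
    · exact Or.inr h
    · exact Or.inl fun h' => absurd h'.1 (not_le.2 h)
  have h1 : ∀ x, m + c ≤ x → ProbabilityTheory.cdf μ x = 1 := by
    intro x hx
    rw [ProbabilityTheory.cdf_eq_real, Measure.real, (prob_compl_eq_zero_iff measurableSet_Iic).1,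
      ENNReal.toReal_one]
    refine measure_mono_null (compl_subset_compl.2 fun y hy => ?_) hm
    exact hy.2.trans hx
  obtain ⟨K, hK⟩ := regSum_cdf_eq h.1 h0 h1
  have := Measure.isProbabilityMeasure_map (μ := μ) (measurable_T α β).aemeasurable
  obtain ⟨K', hK'⟩ := regSum_cdf_eq (A := β * m + α) (B := β * (m + c) + α) h.2
    (fun x hx => by
      rw [cdf_map_T hpos, h0]
      rw [div_le_iff₀ hpos]; linarith)
    (fun x hx => by
      rw [cdf_map_T hpos, h1]
      rw [le_div_iff₀ hpos]; linarith)
  refine ⟨fun x => ProbabilityTheory.cdf μ (x + m), m, m + K, β * m + α + K', fun _ => rfl,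
    fun x y hxy => ProbabilityTheory.monotone_cdf μ (by linarith), fun x hx => h0 _ (by linarith),
    fun x hx => h1 _ (by linarith), fun x => ?_, fun x => ?_⟩
  · rw [regSum_comp_add (ProbabilityTheory.cdf μ) (fun _ => 1), hK]
    ring
  · rw [regSum_comp_add (ProbabilityTheory.cdf μ) (fun _ => 1), abs_of_pos hpos]
    have e : regSum (ProbabilityTheory.cdf μ) (fun _ => 1) (1 / β) (x + m)
        = regSum (ProbabilityTheory.cdf (μ.map (T α β))) (fun _ => 1) 1 (β * (x + m) + α) := by
      unfold regSum
      refine tsum_congr fun n => ?_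
      rw [cdf_map_T hpos]
      congr 2
      field_simp
      ring
    rw [e, hK']
    field_simp
    ring

theorem stmt_12 (α β : ℝ) (hβ : β ≠ 0)
    (μ₁ μ₂ : Measure ℝ) [IsProbabilityMeasure μ₁] [IsProbabilityMeasure μ₂]
    (h₁ : IsCIUPM (T α β) μ₁) (h₂ : IsCIUPM (T α β) μ₂)
    (hd₁ : EMetric.diam (msupp μ₁) = ENNReal.ofReal (cbeta β))
    (hd₂ : EMetric.diam (msupp μ₂) = ENNReal.ofReal (cbeta β)) :
    ∃ γ : ℝ, μ₂ = μ₁.map (T γ 1) := by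
  have hb : 0 < 1 / |β| := one_div_pos.2 (abs_pos.2 hβ)
  have hc : 0 ≤ cbeta β := by
    unfold cbeta
    split_ifs with h
    · have : 1 / (h.choose.num.natAbs : ℝ) ≤ 1 := by
        rw [one_div]
        exact Nat.cast_inv_le_one _
      linarith
    · linarith
  obtain ⟨F₁, m₁, K₁, K₁', hF₁, hm₁, h₁0, h₁1, hK₁, hK₁'⟩ := h₁.exists_normalized_cdf hβ hc hd₁
  obtain ⟨F₂, m₂, K₂, K₂', hF₂, hm₂, h₂0, h₂1, hK₂, hK₂'⟩ := h₂.exists_normalized_cdf hβ hc hd₂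
  have hF : F₁ = F₂ := by
    by_cases h : ∃ r : ℚ, (r : ℝ) = β
    · have hcb : cbeta β = 1 + 1 / |β| - 1 / (h.choose.num.natAbs : ℝ) := dif_pos h
      have hr := h.choose_spec
      set r := h.choose
      rw [hcb] at h₁1 h₂1
      have hr0 : r ≠ 0 := by
        rintro h0
        rw [h0] at hr
        exact hβ (by simpa using hr.symm)
      refine eq_of_rational (Int.natAbs_pos.2 (Rat.num_ne_zero.2 hr0)) r.den_pos r.reduced ?_
        hm₁ h₁0 h₁1 hK₁ hK₁' hm₂ h₂0 h₂1 hK₂ hK₂'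
      rw [← hr, Rat.cast_def, abs_div, Nat.abs_cast, one_div_div, Nat.cast_natAbs, Int.cast_abs]
    · have hcb : cbeta β = 1 + 1 / |β| := dif_neg h
      rw [hcb] at h₁1 h₂1
      have hirr : Irrational (1 / |β|) := by
        rw [one_div, irrational_inv_iff]
        have : Irrational β := fun ⟨r, hr⟩ => h ⟨r, hr⟩
        rcases abs_choice β with e | e <;> rw [e]
        · exact this
        · exact this.neg
      funext x
      rw [eq_of_irrational hb hirr hm₁ h₁0 h₁1 hK₁ hK₁' x,
        eq_of_irrational hb hirr hm₂ h₂0 h₂1 hK₂ hK₂' x]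
  refine ⟨m₂ - m₁, ?_⟩
  have := Measure.isProbabilityMeasure_map (μ := μ₁) (measurable_T (m₂ - m₁) 1).aemeasurable
  refine Measure.eq_of_cdf _ _ ?_
  ext x
  rw [cdf_map_T one_pos]
  have e1 := hF₁ (x - m₂)
  have e2 := hF₂ (x - m₂)
  rw [sub_add_cancel] at e2
  rw [← e2, ← hF, e1]
  congr 1
  ring
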